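/- arXiv:2009.10336 — 2 statements merged into one kernel-verified Lean document; each statement's English description precedes it below -/
import Mathlib

section
/- Let A be a unital C*-algebra and let T : A → A be a symmetric bounded linear map satisfying {T(a), b, 1} + {a, T(b), 1} = 0 for all self-adjoint a, b ∈ A with a·b = 0. Then T(1) is a self-adjoint central element of A and the map D : A → A defined by D(a) := T(a) − T(1)·a is a *-derivation. -/
variable {A : Type*} [NormedRing A] [StarRing A] [CStarRing A]
  [NormedAlgebra ℂ A] [StarModule ℂ A] [CompleteSpace A]

/-- The triple product `{x,y,z} = (1/2)(x y* z + z y* x)` on a C*-algebra. -/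
noncomputable def tp (x y z : A) : A := (2⁻¹ : ℂ) • (x * star y * z + z * star y * x)

section JordanDerivation

variable {R : Type*} [Ring R]

/-- In a `2`-torsion-free semiprime ring, `a x b + b x a = 0` for all `x` forces `a x b = 0`. -/
theorem mul_mul_eq_zero_of_add_swap (h2 : ∀ x : R, x + x = 0 → x = 0)
    (hs : ∀ x : R, (∀ y, x * y * x = 0) → x = 0) {a b : R}
    (h : ∀ x, a * x * b + b * x * a = 0) (x : R) : a * x * b = 0 := by
  refine hs _ fun y => h2 _ ?_
  linear_combination (norm := noncomm_ring)
    h (x * b * y * a * x) - h (x * b * y) * x * a + a * x * b * y * h x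

variable {D : R →+ R}

theorem jordanDerivation_mul_self (h2 : ∀ x : R, x + x = 0 → x = 0)
    (hD : ∀ x y, D (x * y + y * x) = D x * y + x * D y + D y * x + y * D x) (x : R) :
    D (x * x) = D x * x + x * D x := by
  have := hD x x
  rw [map_add] at this
  rw [← sub_eq_zero]
  apply h2
  linear_combination (norm := noncomm_ring) this

theorem jordanDerivation_mul_mul (h2 : ∀ x : R, x + x = 0 → x = 0)
    (hD : ∀ x y, D (x * y + y * x) = D x * y + x * D y + D y * x + y * D x) (x y : R) :
    D (x * y * x) = D x * y * x + x * D y * x + x * y * D x := by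
  have h := hD x (x * y + y * x)
  have h' := hD (x * x) y
  have e : x * (x * y + y * x) + (x * y + y * x) * x
      = (x * x * y + y * (x * x)) + (x * y * x + x * y * x) := by noncomm_ring
  rw [e, map_add, map_add D (x * y * x), h', hD, jordanDerivation_mul_self h2 hD] at h
  rw [← sub_eq_zero]
  apply h2
  linear_combination (norm := noncomm_ring) h

theorem jordanDerivation_mul_mul_add (h2 : ∀ x : R, x + x = 0 → x = 0)
    (hD : ∀ x y, D (x * y + y * x) = D x * y + x * D y + D y * x + y * D x) (x y z : R) :
    D (x * y * z + z * y * x) = D x * y * z + x * D y * z + x * y * D z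
      + D z * y * x + z * D y * x + z * y * D x := by
  have h := jordanDerivation_mul_mul h2 hD (x + z) y
  have e : (x + z) * y * (x + z) = x * y * x + z * y * z + (x * y * z + z * y * x) := by
    noncomm_ring
  rw [e, map_add, map_add D (x * y * x), map_add D x, jordanDerivation_mul_mul h2 hD,
    jordanDerivation_mul_mul h2 hD] at h
  linear_combination (norm := noncomm_ring) h

theorem jordanDerivation_defect_mul_commutator (h2 : ∀ x : R, x + x = 0 → x = 0)
    (hD : ∀ x y, D (x * y + y * x) = D x * y + x * D y + D y * x + y * D x) (a b x : R) :
    (D (a * b) - D a * b - a * D b) * x * (a * b - b * a)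
      + (a * b - b * a) * x * (D (a * b) - D a * b - a * D b) = 0 := by
  have h := jordanDerivation_mul_mul_add h2 hD (a * b) x (b * a)
  have e : a * b * x * (b * a) + b * a * x * (a * b)
      = a * (b * x * b) * a + b * (a * x * a) * b := by noncomm_ring
  have hba : D (b * a) = D a * b + a * D b + D b * a + b * D a - D (a * b) := by
    rw [← hD a b, map_add]; abel
  rw [e, map_add, jordanDerivation_mul_mul h2 hD a, jordanDerivation_mul_mul h2 hD b,
    jordanDerivation_mul_mul h2 hD b, jordanDerivation_mul_mul h2 hD a, hba] at h
  linear_combination (norm := noncomm_ring) h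

theorem jordanDerivation_defect_mul_mul_commutator (h2 : ∀ x : R, x + x = 0 → x = 0)
    (hs : ∀ x : R, (∀ y, x * y * x = 0) → x = 0)
    (hD : ∀ x y, D (x * y + y * x) = D x * y + x * D y + D y * x + y * D x) (a b x u v : R) :
    (D (a * b) - D a * b - a * D b) * x * (u * v - v * u) = 0 := by
  have h0 : ∀ a b x, (D (a * b) - D a * b - a * D b) * x * (a * b - b * a) = 0 := fun a b =>
    mul_mul_eq_zero_of_add_swap h2 hs (jordanDerivation_defect_mul_commutator h2 hD a b)
  have h1 : ∀ a b x u, (D (a * b) - D a * b - a * D b) * x * (u * b - b * u) = 0 := by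
    intro a b x u
    have key : ∀ x, (D (a * b) - D a * b - a * D b) * x * (u * b - b * u)
        + (D (u * b) - D u * b - u * D b) * x * (a * b - b * a) = 0 := by
      intro x
      have := h0 (a + u) b x
      rw [add_mul, map_add, map_add] at this
      linear_combination (norm := noncomm_ring) this - h0 a b x - h0 u b x
    refine hs _ fun y => ?_
    have hz := h0 a b (x * (u * b - b * u) * y * (D (u * b) - D u * b - u * D b) * x)
    have hk := key x
    generalize D (a * b) - D a * b - a * D b = c at *
    generalize D (u * b) - D u * b - u * D b = c' at *
    generalize u * b - b * u = f at *
    generalize a * b - b * a = e at *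
    linear_combination (norm := noncomm_ring) c * x * f * y * hk - hz
  have key : ∀ x, (D (a * b) - D a * b - a * D b) * x * (u * v - v * u)
      + (D (a * v) - D a * v - a * D v) * x * (u * b - b * u) = 0 := by
    intro x
    have := h1 a (b + v) x u
    rw [mul_add a, map_add, map_add] at this
    linear_combination (norm := noncomm_ring) this - h1 a b x u - h1 a v x u
  refine hs _ fun y => ?_
  have hz := h1 a b (x * (u * v - v * u) * y * (D (a * v) - D a * v - a * D v) * x) u
  have hk := key x
  generalize D (a * b) - D a * b - a * D b = c at *
  generalize D (a * v) - D a * v - a * D v = c' at *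
  generalize u * v - v * u = f at *
  generalize u * b - b * u = e at *
  linear_combination (norm := noncomm_ring) c * x * f * y * hk - hz

/-- Brešar's theorem: a Jordan derivation of a `2`-torsion-free semiprime ring is a derivation. -/
theorem jordanDerivation_mul (h2 : ∀ x : R, x + x = 0 → x = 0)
    (hs : ∀ x : R, (∀ y, x * y * x = 0) → x = 0)
    (hD : ∀ x y, D (x * y + y * x) = D x * y + x * D y + D y * x + y * D x) (a b : R) :
    D (a * b) = D a * b + a * D b := by
  have hc := jordanDerivation_defect_mul_mul_commutator h2 hs hD a b
  have hba : D (b * a) = D a * b + a * D b + D b * a + b * D a - D (a * b) := by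
    rw [← hD a b, map_add]; abel
  obtain ⟨c, hcdef⟩ : ∃ c, c = D (a * b) - D a * b - a * D b := ⟨_, rfl⟩
  simp only [← hcdef] at hc
  have hcomm : ∀ y, c * y - y * c = 0 := fun y => hs _ fun x => by
    linear_combination (norm := noncomm_ring) hc (y * x) c y - y * hc x c y
  have h1 : ∀ u v, c * (u * v - v * u) = 0 := fun u v => by simpa using hc 1 u v
  have hDe : D (a * b - b * a)
      = c + c + (D a * b - b * D a) + (a * D b - D b * a) := by
    rw [map_sub, hba, hcdef]; abel
  have hJ := hD c (a * b - b * a)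
  have he : c * (a * b - b * a) + (a * b - b * a) * c = 0 := by
    linear_combination (norm := noncomm_ring) h1 a b + h1 a b - hcomm (a * b - b * a)
  rw [he, map_zero, hDe] at hJ
  have h3 : c * c * c = 0 := by
    apply h2
    apply h2
    linear_combination (norm := noncomm_ring) -(c * hJ) - hc (D c) a b - h1 a b * D c
      - c * h1 (D a) b - c * h1 a (D b) - h1 (D a) b * c - h1 a (D b) * c
  have h4 : c * c = 0 := hs _ fun y => by
    linear_combination (norm := noncomm_ring) h3 * c * y - c * c * hcomm y * c - c * c * c * hcomm y
  have h5 : c = 0 := hs _ fun y => by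
    linear_combination (norm := noncomm_ring) h4 * y - c * hcomm y
  rw [hcdef, sub_sub, sub_eq_zero] at h5
  exact h5

end JordanDerivation

section ZeroProduct

variable {K E : Type*} [TopologicalSpace K] [CompactSpace K] [NormedAddCommGroup E]
  [NormedSpace ℝ E]

/-- A bounded bilinear map `B` satisfies `‖∑ i, B (x i) (z i)‖ ≤ C * X * Z` as soon as
`∑ i, |x i| ≤ X` and `∑ i, |z i| ≤ Z` pointwise. -/
theorem norm_add_sum_bilinear_le (B : C(K, ℝ) →ₗ[ℝ] C(K, ℝ) →ₗ[ℝ] E) {C X Z : ℝ} (hC : 0 ≤ C)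
    (hX : 0 ≤ X) (hZ : 0 ≤ Z) (hB : ∀ f g, ‖B f g‖ ≤ C * ‖f‖ * ‖g‖) {ι : Type*} (s : Finset ι)
    (x z : ι → C(K, ℝ)) (p q : C(K, ℝ)) (hx : ∀ k, |p k| + ∑ i ∈ s, |x i k| ≤ X)
    (hz : ∀ k, |q k| + ∑ i ∈ s, |z i k| ≤ Z) :
    ‖B p q + ∑ i ∈ s, B (x i) (z i)‖ ≤ C * X * Z := by
  classical
  induction s using Finset.induction_on generalizing p q with
  | empty =>
    simp only [Finset.sum_empty, add_zero] at hx hz ⊢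
    have hp : ‖p‖ ≤ X := (ContinuousMap.norm_le _ hX).2 hx
    have hq : ‖q‖ ≤ Z := (ContinuousMap.norm_le _ hZ).2 hz
    exact (hB p q).trans (by gcongr)
  | insert i s hi ih =>
    simp only [Finset.sum_insert hi] at hx hz ⊢
    have h₁ := ih (p + x i) (q + z i)
      (fun k => by
        have := hx k; have := abs_add_le (p k) (x i k); rw [ContinuousMap.add_apply]; linarith)
      (fun k => by
        have := hz k; have := abs_add_le (q k) (z i k); rw [ContinuousMap.add_apply]; linarith)
    have h₂ := ih (p - x i) (q - z i)
      (fun k => by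
        have := hx k; have := abs_sub (p k) (x i k); rw [ContinuousMap.sub_apply]; linarith)
      (fun k => by
        have := hz k; have := abs_sub (q k) (z i k); rw [ContinuousMap.sub_apply]; linarith)
    have e : B p q + (B (x i) (z i) + ∑ i ∈ s, B (x i) (z i))
        = (2⁻¹ : ℝ) • ((B (p + x i) (q + z i) + ∑ i ∈ s, B (x i) (z i))
          + (B (p - x i) (q - z i) + ∑ i ∈ s, B (x i) (z i))) := by
      simp only [map_add, map_sub, LinearMap.add_apply, LinearMap.sub_apply]
      module
    rw [e, norm_smul, norm_inv, Real.norm_ofNat]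
    have := norm_add_le (B (p + x i) (q + z i) + ∑ i ∈ s, B (x i) (z i))
      (B (p - x i) (q - z i) + ∑ i ∈ s, B (x i) (z i))
    linarith

/-- The function `t ↦ min 1 (max 0 t)`. -/
noncomputable def clampUnit (t : ℝ) : ℝ := min 1 (max 0 t)

theorem continuous_clampUnit : Continuous clampUnit := by
  unfold clampUnit; fun_prop

theorem monotone_clampUnit : Monotone clampUnit := fun _ _ h => by
  unfold clampUnit; gcongr

theorem clampUnit_of_nonpos {t : ℝ} (h : t ≤ 0) : clampUnit t = 0 := by
  simp [clampUnit, h]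

theorem clampUnit_of_one_le {t : ℝ} (h : 1 ≤ t) : clampUnit t = 1 := by
  simp [clampUnit, h]

theorem clampUnit_nonneg (t : ℝ) : 0 ≤ clampUnit t := by simp [clampUnit]

theorem clampUnit_le_one (t : ℝ) : clampUnit t ≤ 1 := by simp [clampUnit]

/-- The hat function supported on `[n - 1, n + 1]`. -/
noncomputable def hat (n : ℕ) (t : ℝ) : ℝ := clampUnit (t - n + 1) - clampUnit (t - n)

/-- The trapezoid function supported on `[n - 2, n + 2]`, equal to `1` on `[n - 1, n + 1]`. -/
noncomputable def trapezoid (n : ℕ) (t : ℝ) : ℝ :=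
  clampUnit (t - n + 2) - clampUnit (t - n - 1)

theorem continuous_hat (n : ℕ) : Continuous (hat n) := by
  unfold hat
  exact (continuous_clampUnit.comp (by fun_prop)).sub (continuous_clampUnit.comp (by fun_prop))

theorem continuous_trapezoid (n : ℕ) : Continuous (trapezoid n) := by
  unfold trapezoid
  exact (continuous_clampUnit.comp (by fun_prop)).sub (continuous_clampUnit.comp (by fun_prop))

theorem hat_nonneg (n : ℕ) (t : ℝ) : 0 ≤ hat n t :=
  sub_nonneg.2 (monotone_clampUnit (by linarith))

theorem trapezoid_nonneg (n : ℕ) (t : ℝ) : 0 ≤ trapezoid n t :=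
  sub_nonneg.2 (monotone_clampUnit (by linarith))

theorem hat_eq_zero {n : ℕ} {t : ℝ} (h : 1 ≤ |t - n|) : hat n t = 0 := by
  unfold hat
  rcases le_abs.1 h with h | h
  · rw [clampUnit_of_one_le (by linarith), clampUnit_of_one_le (by linarith), sub_self]
  · rw [clampUnit_of_nonpos (by linarith), clampUnit_of_nonpos (by linarith), sub_self]

theorem trapezoid_eq_zero {n : ℕ} {t : ℝ} (h : 2 ≤ |t - n|) : trapezoid n t = 0 := by
  unfold trapezoid
  rcases le_abs.1 h with h | h
  · rw [clampUnit_of_one_le (by linarith), clampUnit_of_one_le (by linarith), sub_self]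
  · rw [clampUnit_of_nonpos (by linarith), clampUnit_of_nonpos (by linarith), sub_self]

theorem trapezoid_eq_one {n : ℕ} {t : ℝ} (h : |t - n| ≤ 1) : trapezoid n t = 1 := by
  have := abs_le.1 h
  unfold trapezoid
  rw [clampUnit_of_one_le (by linarith), clampUnit_of_nonpos (by linarith), sub_zero]

theorem abs_sub_mul_hat_le (n : ℕ) (t : ℝ) : |t - n| * hat n t ≤ hat n t := by
  by_cases h : 1 ≤ |t - n|
  · simp [hat_eq_zero h]
  · exact mul_le_of_le_one_left (hat_nonneg n t) (not_le.1 h).le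

theorem abs_sub_mul_trapezoid_le (n : ℕ) (t : ℝ) :
    |t - n| * trapezoid n t ≤ 2 * trapezoid n t := by
  by_cases h : 2 ≤ |t - n|
  · simp [trapezoid_eq_zero h]
  · exact mul_le_mul_of_nonneg_right (not_le.1 h).le (trapezoid_nonneg n t)

theorem hat_mul_one_sub_trapezoid (n : ℕ) (t : ℝ) : hat n t * (1 - trapezoid n t) = 0 := by
  by_cases h : 1 ≤ |t - n|
  · simp [hat_eq_zero h]
  · simp [trapezoid_eq_one (not_le.1 h).le]

theorem sum_hat (N : ℕ) (t : ℝ) :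
    ∑ n ∈ Finset.range N, hat n t = clampUnit (t + 1) - clampUnit (t + 1 - N) := by
  have := Finset.sum_range_sub' (fun n : ℕ => clampUnit (t + 1 - n)) N
  simp only [Nat.cast_zero, sub_zero] at this
  rw [← this]
  refine Finset.sum_congr rfl fun n _ => ?_
  unfold hat
  push_cast
  congr 2 <;> ring

theorem sum_hat_le_one (N : ℕ) (t : ℝ) : ∑ n ∈ Finset.range N, hat n t ≤ 1 := by
  rw [sum_hat]; linarith [clampUnit_le_one (t + 1), clampUnit_nonneg (t + 1 - N)]

theorem trapezoid_eq (n : ℕ) (t : ℝ) :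
    trapezoid n t = hat n (t + 1) + hat n t + hat n (t - 1) := by
  unfold trapezoid hat; ring_nf

theorem sum_trapezoid_le (N : ℕ) (t : ℝ) : ∑ n ∈ Finset.range N, trapezoid n t ≤ 3 := by
  simp only [trapezoid_eq, Finset.sum_add_distrib]
  linarith [sum_hat_le_one N t, sum_hat_le_one N (t + 1), sum_hat_le_one N (t - 1)]

/-- Multiplication by `y ≥ 0` is balanced up to an error independent of `y`. -/
theorem norm_bilinear_mul_sub_le (B : C(K, ℝ) →ₗ[ℝ] C(K, ℝ) →ₗ[ℝ] E) {C : ℝ} (hC : 0 ≤ C)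
    (hB : ∀ f g, ‖B f g‖ ≤ C * ‖f‖ * ‖g‖) (h0 : ∀ f g, f * g = 0 → B f g = 0)
    (y f g : C(K, ℝ)) (hy : ∀ k, 0 ≤ y k) :
    ‖B (y * f) g - B f (y * g)‖ ≤ 9 * C * ‖f‖ * ‖g‖ := by
  obtain ⟨N, hN⟩ := exists_nat_gt ‖y‖
  set s := Finset.range (N + 1)
  let u (n : ℕ) : C(K, ℝ) := ⟨fun k => hat n (y k), (continuous_hat n).comp y.continuous⟩
  let v (n : ℕ) : C(K, ℝ) :=
    ⟨fun k => trapezoid n (y k), (continuous_trapezoid n).comp y.continuous⟩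
  have hu : ∑ n ∈ s, u n = 1 := by
    ext k
    have hk : y k ≤ N := ((le_abs_self _).trans (y.norm_coe_le_norm k)).trans hN.le
    rw [ContinuousMap.sum_apply, ContinuousMap.one_apply]
    change ∑ n ∈ s, hat n (y k) = 1
    rw [sum_hat, clampUnit_of_one_le (by linarith [hy k]),
      clampUnit_of_nonpos (by push_cast; linarith), sub_zero]
  have huv (n : ℕ) (a b : C(K, ℝ)) : B (u n * a) b = B (u n * a) (v n * b) := by
    rw [← sub_eq_zero, ← map_sub]
    refine h0 _ _ ?_
    have : u n * (1 - v n) = 0 := by ext k; exact hat_mul_one_sub_trapezoid n (y k)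
    linear_combination a * b * this
  let w (n : ℕ) : C(K, ℝ) := y - algebraMap ℝ _ (n : ℝ)
  have key : B (y * f) g - B f (y * g)
      = ∑ n ∈ s, B (u n * (w n * f)) (v n * g) - ∑ n ∈ s, B (u n * f) (v n * (w n * g)) := by
    simp only [← huv]
    have h1 : y * f = ∑ n ∈ s, u n * (y * f) := by rw [← Finset.sum_mul, hu, one_mul]
    have h2 : f = ∑ n ∈ s, u n * f := by rw [← Finset.sum_mul, hu, one_mul]
    conv_lhs => rw [h1]; arg 2; rw [h2]
    simp only [map_sum, LinearMap.sum_apply]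
    rw [← Finset.sum_sub_distrib, ← Finset.sum_sub_distrib]
    refine Finset.sum_congr rfl fun n _ => ?_
    simp only [w, sub_mul, mul_sub, map_sub, LinearMap.sub_apply, Algebra.algebraMap_eq_smul_one,
      smul_mul_assoc, mul_smul_comm, one_mul, map_smul, LinearMap.smul_apply]
    abel
  have bound (x : ℕ → ℝ) (hx : ∀ n, 0 ≤ x n) {M : ℝ} (hM : ∑ n ∈ s, x n ≤ M)
      (r : ℕ → ℝ) {a : ℝ} {c F : ℝ} (hc : 0 ≤ c) (hF : 0 ≤ F)
      (hr : ∀ n, |r n| * x n ≤ c * x n) (ha : |a| ≤ F) :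
      |0| + ∑ n ∈ s, |x n * (r n * a)| ≤ c * M * F := by
    rw [abs_zero, zero_add]
    calc ∑ n ∈ s, |x n * (r n * a)| ≤ ∑ n ∈ s, c * x n * F := by
          refine Finset.sum_le_sum fun n _ => ?_
          rw [abs_mul, abs_mul, abs_of_nonneg (hx n), ← mul_assoc, mul_comm (x n)]
          have := hx n
          exact mul_le_mul (hr n) ha (abs_nonneg a) (by positivity)
      _ = c * (∑ n ∈ s, x n) * F := by rw [← Finset.sum_mul, Finset.mul_sum]
      _ ≤ c * M * F := by gcongr
  have e1 := norm_add_sum_bilinear_le B hC (X := 1 * 1 * ‖f‖) (Z := 1 * 3 * ‖g‖) (by positivity)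
    (by positivity) hB s (fun n => u n * (w n * f)) (fun n => v n * g) 0 0
    (fun k => bound _ (fun n => hat_nonneg n _) (sum_hat_le_one _ _) (fun n => y k - n) zero_le_one
      (norm_nonneg f) (fun n => by simpa using abs_sub_mul_hat_le n _) (f.norm_coe_le_norm k))
    (fun k => by
      simpa [u, v] using bound _ (fun n => trapezoid_nonneg n _) (sum_trapezoid_le _ (y k))
        (fun n => 1) zero_le_one (norm_nonneg g) (fun n => by simp) (g.norm_coe_le_norm k))
  have e2 := norm_add_sum_bilinear_le B hC (X := 1 * 1 * ‖f‖) (Z := 2 * 3 * ‖g‖) (by positivity)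
    (by positivity) hB s (fun n => u n * f) (fun n => v n * (w n * g)) 0 0
    (fun k => by
      simpa [u, v] using bound _ (fun n => hat_nonneg n _) (sum_hat_le_one _ (y k))
        (fun n => 1) zero_le_one (norm_nonneg f) (fun n => by simp) (f.norm_coe_le_norm k))
    (fun k => bound _ (fun n => trapezoid_nonneg n _) (sum_trapezoid_le _ _) (fun n => y k - n)
      zero_le_two (norm_nonneg g) (fun n => abs_sub_mul_trapezoid_le n _) (g.norm_coe_le_norm k))
  rw [map_zero, zero_add] at e1 e2
  rw [key]
  refine (norm_sub_le _ _).trans ?_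
  linarith

/-- A bounded bilinear map on `C(K, ℝ)` vanishing on pairs with product zero is balanced. -/
theorem bilinear_mul_eq_of_zero_product (B : C(K, ℝ) →ₗ[ℝ] C(K, ℝ) →ₗ[ℝ] E) {C : ℝ} (hC : 0 ≤ C)
    (hB : ∀ f g, ‖B f g‖ ≤ C * ‖f‖ * ‖g‖) (h0 : ∀ f g, f * g = 0 → B f g = 0)
    (h f g : C(K, ℝ)) : B (h * f) g = B f (h * g) := by
  rw [← sub_eq_zero, ← norm_le_zero_iff]
  by_contra! hpos
  obtain ⟨N, hN⟩ := exists_nat_gt (9 * C * ‖f‖ * ‖g‖ / ‖B (h * f) g - B f (h * g)‖)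
  rw [div_lt_iff₀ hpos] at hN
  have := norm_bilinear_mul_sub_le B hC hB h0 ((N : ℝ) • (h + algebraMap ℝ _ ‖h‖)) f g
    (fun k => by
      have : -‖h‖ ≤ h k := (abs_le.1 (h.norm_coe_le_norm k)).1
      change 0 ≤ (N : ℝ) * (h k + ‖h‖)
      exact mul_nonneg (by positivity) (by linarith))
  have e : B ((N : ℝ) • (h + algebraMap ℝ _ ‖h‖) * f) g
      - B f ((N : ℝ) • (h + algebraMap ℝ _ ‖h‖) * g) = (N : ℝ) • (B (h * f) g - B f (h * g)) := by
    simp only [add_mul, map_add, LinearMap.add_apply, Algebra.algebraMap_eq_smul_one,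
      smul_mul_assoc, one_mul, map_smul, LinearMap.smul_apply]
    module
  rw [e, norm_smul, Real.norm_natCast] at this
  linarith

end ZeroProduct

section Commutator

variable {𝔄 : Type*} [CStarAlgebra 𝔄]

open Complex NormedSpace in
/-- For self-adjoint `a`, if `a` commutes with `[a, k]` then `[a, k] = 0`. -/
theorem commutator_eq_zero_of_isSelfAdjoint {a k : 𝔄} (ha : IsSelfAdjoint a)
    (h : a * (a * k - k * a) = (a * k - k * a) * a) : a * k - k * a = 0 := by
  let +nondep : NormedAlgebra ℚ 𝔄 := .restrictScalars ℚ ℂ 𝔄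
  obtain ⟨c, hc⟩ : ∃ c, c = a * k - k * a := ⟨_, rfl⟩
  rw [← hc] at h ⊢
  set b : 𝔄 := I • a with hb
  have hbc : b * k - k * b = I • c := by
    rw [hc, hb, smul_mul_assoc, mul_smul_comm, smul_sub]
  have hcomm : Commute b c := (show Commute a c from h).smul_left I
  let G : ℝ → 𝔄 := fun t => exp (t • b) * k * exp (t • (-b)) - t • (I • c)
  have hG (t : ℝ) : HasDerivAt G 0 t := by
    have h1 := ((hasDerivAt_exp_smul_const b t).mul_const k).mul (hasDerivAt_exp_smul_const' (-b) t)
    have h2 := h1.sub ((hasDerivAt_id t).smul_const (I • c))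
    refine h2.congr_deriv ?_
    have h3 : exp (t • b) * (I • c) * exp (t • (-b)) = I • c := by
      have : Commute (exp (t • b)) (I • c) := (hcomm.smul_left t).exp_left.smul_right I
      rw [this.eq, mul_assoc, smul_neg, ← exp_add_of_commute (Commute.neg_right (.refl _)),
        add_neg_cancel, NormedSpace.exp_zero, mul_one]
    rw [one_smul, sub_eq_zero, ← h3, ← hbc]
    noncomm_ring
  have hconst (t : ℝ) : G t = k := by
    have := is_const_of_deriv_eq_zero (fun t => (hG t).differentiableAt)
      (fun t => (hG t).deriv) t 0
    simpa [G] using this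
  have hU (t : ℝ) (d : 𝔄) (hd : d ∈ skewAdjoint 𝔄) : NormedSpace.exp (t • d) ∈ unitary 𝔄 :=
    exp_mem_unitary_of_mem_skewAdjoint (skewAdjoint.smul_mem t hd)
  have hbs : b ∈ skewAdjoint 𝔄 := ha.smul_mem_skewAdjoint conj_I
  have hle (t : ℝ) : |t| * ‖c‖ ≤ 2 * ‖k‖ := by
    have e : t • (I • c) = exp (t • b) * k * exp (t • (-b)) - k := by
      have := hconst t
      simp only [G] at this
      rw [eq_sub_iff_add_eq, ← sub_eq_iff_eq_add'.1 this]
    calc |t| * ‖c‖ = ‖t • (I • c)‖ := by simp [norm_smul]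
      _ ≤ ‖exp (t • b) * k * exp (t • (-b))‖ + ‖k‖ := by rw [e]; exact norm_sub_le _ _
      _ = 2 * ‖k‖ := by
          rw [CStarRing.norm_mul_mem_unitary _ (hU t _ (neg_mem hbs)),
            CStarRing.norm_mem_unitary_mul _ (hU t b hbs), two_mul]
  rw [← norm_le_zero_iff]
  by_contra! hpos
  obtain ⟨N, hN⟩ := exists_nat_gt (2 * ‖k‖ / ‖c‖)
  rw [div_lt_iff₀ hpos] at hN
  have := hle N
  rw [Nat.abs_cast] at this
  linarith

end Commutator

section OrthogonalPairs

variable {𝔄 : Type*} [CStarAlgebra 𝔄] {T : 𝔄 →L[ℂ] 𝔄}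

theorem map_mul_self_of_orthogonal
    (hT : ∀ a b : 𝔄, IsSelfAdjoint a → IsSelfAdjoint b → a * b = 0 →
      T a * b + b * T a + a * T b + T b * a = 0) {a : 𝔄} (ha : IsSelfAdjoint a) :
    (2 : ℂ) • (T a * a + a * T a)
      = (2 : ℂ) • T (a * a) + T 1 * (a * a) + a * a * T 1 := by
  let ψ := cfcHom (R := ℝ) ha
  have hψ (f) : IsSelfAdjoint (ψ f) := (IsSelfAdjoint.all f).map ψ
  have hn (f) : ‖ψ f‖ = ‖f‖ := norm_cfcHom a f ha
  let B : C(spectrum ℝ a, ℝ) →ₗ[ℝ] C(spectrum ℝ a, ℝ) →ₗ[ℝ] 𝔄 :=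
    LinearMap.mk₂ ℝ (fun f g => T (ψ f) * ψ g + ψ g * T (ψ f) + ψ f * T (ψ g) + T (ψ g) * ψ f)
      (fun f f' g => by simp only [map_add]; noncomm_ring)
      (fun r f g => by
        simp only [map_smul, T.map_smul_of_tower, smul_mul_assoc, mul_smul_comm, smul_add])
      (fun f g g' => by simp only [map_add]; noncomm_ring)
      (fun r f g => by
        simp only [map_smul, T.map_smul_of_tower, smul_mul_assoc, mul_smul_comm, smul_add])
  have hB (f g) : ‖B f g‖ ≤ 4 * ‖T‖ * ‖f‖ * ‖g‖ := by
    have h1 (f g) : ‖T (ψ f) * ψ g‖ ≤ ‖T‖ * ‖f‖ * ‖g‖ := by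
      rw [← hn f, ← hn g]
      exact (norm_mul_le _ _).trans (by gcongr; exact T.le_opNorm _)
    have h2 (f g) : ‖ψ g * T (ψ f)‖ ≤ ‖T‖ * ‖f‖ * ‖g‖ := by
      rw [← hn f, ← hn g, mul_comm _ ‖ψ g‖]
      exact (norm_mul_le _ _).trans (by gcongr; exact T.le_opNorm _)
    refine norm_add₄_le.trans ?_
    linarith [h1 f g, h2 f g, h1 g f, h2 g f]
  have h0 (f g) (hfg : f * g = 0) : B f g = 0 :=
    hT _ _ (hψ f) (hψ g) (by rw [← map_mul, hfg, map_zero])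
  have key := bilinear_mul_eq_of_zero_product B (by positivity) hB h0
    (.restrict (spectrum ℝ a) (.id ℝ)) 1 (.restrict (spectrum ℝ a) (.id ℝ))
  have hid : ψ (.restrict (spectrum ℝ a) (.id ℝ)) = a := cfcHom_id ha
  simp only [B, LinearMap.mk₂_apply, mul_one, map_mul, map_one, hid, one_mul] at key
  rw [two_smul, two_smul]
  linear_combination (norm := noncomm_ring) key

theorem map_jordan_of_orthogonal
    (hT : ∀ a b : 𝔄, IsSelfAdjoint a → IsSelfAdjoint b → a * b = 0 →
      T a * b + b * T a + a * T b + T b * a = 0) (a b : 𝔄) :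
    (2 : ℂ) • (T a * b + a * T b + T b * a + b * T a)
      = (2 : ℂ) • T (a * b + b * a) + T 1 * (a * b + b * a) + (a * b + b * a) * T 1 := by
  have h1 (a b : 𝔄) (ha : IsSelfAdjoint a) (hb : IsSelfAdjoint b) :
      (2 : ℂ) • (T a * b + a * T b + T b * a + b * T a)
        = (2 : ℂ) • T (a * b + b * a) + T 1 * (a * b + b * a) + (a * b + b * a) * T 1 := by
    have h := map_mul_self_of_orthogonal hT (ha.add hb)
    simp only [map_add, add_mul, mul_add, two_smul] at h ⊢
    have ha' := map_mul_self_of_orthogonal hT ha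
    have hb' := map_mul_self_of_orthogonal hT hb
    simp only [two_smul] at ha' hb'
    linear_combination (norm := noncomm_ring) h - ha' - hb'
  have h2 (a b : 𝔄) (ha : IsSelfAdjoint a) :
      (2 : ℂ) • (T a * b + a * T b + T b * a + b * T a)
        = (2 : ℂ) • T (a * b + b * a) + T 1 * (a * b + b * a) + (a * b + b * a) * T 1 := by
    have hr := h1 a (realPart b) ha (realPart b).2
    have hi := h1 a (imaginaryPart b) ha (imaginaryPart b).2
    have e := realPart_add_I_smul_imaginaryPart b
    generalize (realPart b : 𝔄) = x at *
    generalize (imaginaryPart b : 𝔄) = y at *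
    rw [← e]
    have hi' := congrArg (Complex.I • ·) hi
    simp only [map_add, map_smul, mul_add, add_mul, smul_add, smul_mul_assoc, mul_smul_comm,
      smul_comm Complex.I (2 : ℂ)] at hr hi' ⊢
    linear_combination (norm := abel) hr + hi'
  have hr := h2 (realPart a) b (realPart a).2
  have hi := h2 (imaginaryPart a) b (imaginaryPart a).2
  have e := realPart_add_I_smul_imaginaryPart a
  generalize (realPart a : 𝔄) = x at *
  generalize (imaginaryPart a : 𝔄) = y at *
  rw [← e]
  have hi' := congrArg (Complex.I • ·) hi
  simp only [map_add, map_smul, mul_add, add_mul, smul_add, smul_mul_assoc, mul_smul_comm,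
    smul_comm Complex.I (2 : ℂ)] at hr hi' ⊢
  linear_combination (norm := abel) hr + hi'

theorem commute_map_one_of_orthogonal
    (hT : ∀ a b : 𝔄, IsSelfAdjoint a → IsSelfAdjoint b → a * b = 0 →
      T a * b + b * T a + a * T b + T b * a = 0) (x : 𝔄) : T 1 * x = x * T 1 := by
  have hsa (a : 𝔄) (ha : IsSelfAdjoint a) : a * T 1 - T 1 * a = 0 := by
    have hJ := map_jordan_of_orthogonal hT
    have h22 := hJ (a * a) (a * a)
    have h13 := hJ a (a * a * a)
    have h12 := hJ a (a * a)
    have h11 := hJ a a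
    simp only [map_add, ← mul_assoc] at h22 h13 h12 h11
    generalize T 1 = h at *
    generalize T (a * a * a * a) = t4 at *
    generalize T (a * a * a) = t3 at *
    generalize T (a * a) = t2 at *
    generalize T a = t at *
    have key : a * (a * (a * (a * h - h * a) - (a * h - h * a) * a)
          - (a * (a * h - h * a) - (a * h - h * a) * a) * a)
        - (a * (a * (a * h - h * a) - (a * h - h * a) * a)
          - (a * (a * h - h * a) - (a * h - h * a) * a) * a) * a = 0 := by
      have h0 : ∀ x : 𝔄, (2 : ℂ) • x = 0 → x = 0 := fun x hx =>
        (smul_eq_zero.1 hx).resolve_left two_ne_zero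
      apply h0
      simp only [two_smul] at h22 h13 h12 h11 ⊢
      linear_combination (norm := noncomm_ring) 4 * h13 - 4 * h22 + 2 * a * h12 + 2 * h12 * a
        - 3 * a * a * h11 - 3 * h11 * a * a + 2 * a * h11 * a
    exact commutator_eq_zero_of_isSelfAdjoint ha <| sub_eq_zero.1 <|
      commutator_eq_zero_of_isSelfAdjoint ha <| sub_eq_zero.1 <|
      commutator_eq_zero_of_isSelfAdjoint ha <| sub_eq_zero.1 key
  have hr := hsa _ (realPart x).2
  have hi := hsa _ (imaginaryPart x).2
  rw [← realPart_add_I_smul_imaginaryPart x, mul_add, add_mul, mul_smul_comm, smul_mul_assoc,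
    ← sub_eq_zero.1 hr, ← sub_eq_zero.1 hi]

theorem map_mul_sub_of_orthogonal
    (hT : ∀ a b : 𝔄, IsSelfAdjoint a → IsSelfAdjoint b → a * b = 0 →
      T a * b + b * T a + a * T b + T b * a = 0) (x y : 𝔄) :
    T (x * y) - T 1 * (x * y) = (T x - T 1 * x) * y + x * (T y - T 1 * y) := by
  have hc := commute_map_one_of_orthogonal hT
  have hh (x : 𝔄) (hx : x + x = 0) : x = 0 := by
    rw [← two_smul ℂ] at hx
    exact (smul_eq_zero.1 hx).resolve_left two_ne_zero
  have hs (x : 𝔄) (hx : ∀ y, x * y * x = 0) : x = 0 := by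
    have h := hx (star x)
    rw [← CStarRing.star_mul_self_eq_zero_iff, ← CStarRing.star_mul_self_eq_zero_iff]
    rw [star_mul, star_star, mul_assoc, ← mul_assoc x, h, mul_zero]
  let D : 𝔄 →+ 𝔄 :=
    { toFun := fun x => T x - T 1 * x
      map_zero' := by simp
      map_add' := fun x y => by rw [map_add, mul_add]; abel }
  have hDapp (x : 𝔄) : D x = T x - T 1 * x := rfl
  refine jordanDerivation_mul (D := D) hh hs (fun x y => ?_) x y
  have h := map_jordan_of_orthogonal hT x y
  simp only [hDapp, two_smul] at h ⊢
  rw [← sub_eq_zero]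
  apply hh
  linear_combination (norm := noncomm_ring) -h - 2 * hc x * y - 2 * hc y * x + hc (x * y) + hc (y * x)

end OrthogonalPairs

/-- a symmetric bounded linear map on a unital C*-algebra satisfying
`{T a, b, 1} + {a, T b, 1} = 0` for all orthogonal self-adjoint `a, b` has `T 1`
a self-adjoint central element and `D a := T a - T 1 * a` a `*`-derivation. -/
theorem stmt14 (T : A →L[ℂ] A)
    (hsym : ∀ x : A, star (T (star x)) = T x)
    (hT : ∀ a b : A, IsSelfAdjoint a → IsSelfAdjoint b → a * b = 0 →
      tp (T a) b 1 + tp a (T b) 1 = 0) :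
    IsSelfAdjoint (T 1) ∧ (∀ x : A, T 1 * x = x * T 1) ∧
    (∀ x y : A, (T (x * y) - T 1 * (x * y)) =
        (T x - T 1 * x) * y + x * (T y - T 1 * y)) ∧
    (∀ x : A, T (star x) - T 1 * star x = star (T x - T 1 * x)) := by
  let : CStarAlgebra A := {}
  have hT' (a b : A) (ha : IsSelfAdjoint a) (hb : IsSelfAdjoint b) (hab : a * b = 0) :
      T a * b + b * T a + a * T b + T b * a = 0 := by
    have hTb : star (T b) = T b := by simpa only [hb.star_eq] using hsym b
    have h := hT a b ha hb hab
    simp only [tp, hb.star_eq, hTb, mul_one, one_mul, ← smul_add, ← add_assoc] at h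
    exact (smul_eq_zero.1 h).resolve_left (inv_ne_zero two_ne_zero)
  have h1 : IsSelfAdjoint (T 1) := by
    rw [IsSelfAdjoint]
    simpa only [star_one] using hsym 1
  have hc := commute_map_one_of_orthogonal hT'
  refine ⟨h1, hc, map_mul_sub_of_orthogonal hT', fun x => ?_⟩
  rw [star_sub, star_mul, h1.star_eq, hc, ← hsym (star x), star_star]
end

section
/- Let A be a unital C*-algebra and let T : A → A be an anti-symmetric bounded linear map satisfying {T(a), b, 1} + {a, T(b), 1} = 0 for all self-adjoint a, b ∈ A with a·b = 0. Then T(1) is skew-adjoint, T(x) = (1/2)(T(1)·x + x·T(1)) for all x ∈ A, and T is a triple derivation. -/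
variable {A : Type*} [NormedRing A] [StarRing A] [CStarRing A]
  [NormedAlgebra ℂ A] [StarModule ℂ A] [CompleteSpace A]

/-- A triple derivation. -/
def IsTripleDerivation (δ : A → A) : Prop :=
  ∀ a b c : A, δ (tp a b c) = tp (δ a) b c + tp a (δ b) c + tp a b (δ c)

section OrthogonalForms

variable {X : Type*} [TopologicalSpace X]

/-- The truncation of `g - s` to the interval `[0, 1]`. -/
def unitRamp (g : C(X, ℝ)) (s : ℝ) : C(X, ℝ) where
  toFun x := max 0 (min 1 (g x - s))
  continuous_toFun := by fun_prop

/-- The difference of two consecutive ramps, a tent function of `g` centred at `s`. -/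
def unitTent (g : C(X, ℝ)) (s : ℝ) : C(X, ℝ) := unitRamp g (s - 1) - unitRamp g s

lemma unitRamp_apply (g : C(X, ℝ)) (s : ℝ) (x : X) :
    unitRamp g s x = max 0 (min 1 (g x - s)) := rfl

lemma unitTent_apply (g : C(X, ℝ)) (s : ℝ) (x : X) :
    unitTent g s x = max 0 (min 1 (g x - (s - 1))) - max 0 (min 1 (g x - s)) := rfl

lemma unitRamp_antitone (g : C(X, ℝ)) (x : X) : Antitone fun s => unitRamp g s x := by
  intro s t hst
  simp only [unitRamp_apply]
  gcongr

lemma unitTent_eq_zero_of_le {g : C(X, ℝ)} {s : ℝ} {x : X} (h : g x ≤ s - 1) :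
    unitTent g s x = 0 := by
  rw [unitTent_apply]
  grind

lemma unitTent_eq_zero_of_ge {g : C(X, ℝ)} {s : ℝ} {x : X} (h : s + 1 ≤ g x) :
    unitTent g s x = 0 := by
  rw [unitTent_apply]
  grind

lemma unitRamp_mul_one_sub (g : C(X, ℝ)) (s : ℝ) :
    unitRamp g s * (1 - unitRamp g (s - 1)) = 0 := by
  ext x
  simp only [ContinuousMap.mul_apply, ContinuousMap.sub_apply, ContinuousMap.one_apply,
    ContinuousMap.zero_apply, unitRamp_apply, mul_eq_zero]
  grind

lemma unitRamp_mul_unitTent (g : C(X, ℝ)) (s : ℝ) :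
    unitRamp g (s + 1) * unitTent g s = 0 := by
  ext x
  rcases le_total (g x) (s + 1) with h | h
  · have : unitRamp g (s + 1) x = 0 := by rw [unitRamp_apply]; grind
    simp [this]
  · simp [unitTent_eq_zero_of_ge h]

lemma unitTent_mul_unitTent {g : C(X, ℝ)} {s t : ℝ} (h : s + 2 ≤ t) :
    unitTent g s * unitTent g t = 0 := by
  ext x
  rcases le_total (g x) (s + 1) with hx | hx
  · simp [unitTent_eq_zero_of_le (show g x ≤ t - 1 by linarith)]
  · simp [unitTent_eq_zero_of_ge hx]

lemma norm_sum_unitTent_le [CompactSpace X] (g : C(X, ℝ)) (s : ℝ) (m : ℕ) :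
    ‖∑ j ∈ Finset.range m, unitTent g (s + 3 * j)‖ ≤ 1 := by
  rw [ContinuousMap.norm_le _ zero_le_one]
  intro x
  have hnn : ∀ r, 0 ≤ unitTent g r x := fun r =>
    sub_nonneg.2 (unitRamp_antitone g x (by linarith))
  have hle : ∑ j ∈ Finset.range m, unitTent g (s + 3 * j) x ≤
      ∑ j ∈ Finset.range m, (unitRamp g (s - 1 + 3 * (j : ℕ)) x -
        unitRamp g (s - 1 + 3 * ((j + 1 : ℕ) : ℝ)) x) := by
    refine Finset.sum_le_sum fun j _ => ?_
    have h₁ : unitTent g (s + 3 * j) x =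
        unitRamp g (s - 1 + 3 * j) x - unitRamp g (s + 3 * j) x := by
      rw [show s - 1 + 3 * (j : ℝ) = s + 3 * j - 1 by ring]; rfl
    rw [h₁]
    refine sub_le_sub_left (unitRamp_antitone g x ?_) _
    push_cast
    linarith
  rw [Finset.sum_range_sub' (fun j : ℕ => unitRamp g (s - 1 + 3 * (j : ℝ)) x)] at hle
  have h₀ : ∀ r, 0 ≤ unitRamp g r x := fun r => le_max_left _ _
  have h₁ : ∀ r, unitRamp g r x ≤ 1 := fun r => max_le zero_le_one (min_le_left _ _)
  rw [ContinuousMap.sum_apply, Real.norm_of_nonneg (Finset.sum_nonneg fun j _ => hnn _)]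
  linarith [h₀ (s - 1 + 3 * (m : ℝ)), h₁ (s - 1 + 3 * ((0 : ℕ) : ℝ))]

lemma sum_unitRamp {g : C(X, ℝ)} {m : ℕ} (h₀ : ∀ x, 0 ≤ g x) (h₁ : ∀ x, g x ≤ 3 * m) :
    ∑ j ∈ Finset.range m, (unitRamp g (0 + 3 * j) + unitRamp g (1 + 3 * j) +
      unitRamp g (2 + 3 * j)) = g := by
  ext x
  suffices ∀ k : ℕ, (∑ j ∈ Finset.range k, (unitRamp g (0 + 3 * j) + unitRamp g (1 + 3 * j) +
      unitRamp g (2 + 3 * j))) x = min (g x) (3 * k) by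
    rw [this, min_eq_left (h₁ x)]
  intro k
  induction k with
  | zero => simp [h₀ x]
  | succ k ih =>
    rw [Finset.sum_range_succ, ContinuousMap.add_apply, ih]
    simp only [ContinuousMap.add_apply, unitRamp_apply]
    have hk : (0 : ℝ) ≤ k := k.cast_nonneg
    push_cast
    have := h₀ x
    grind

variable {F : Type*} [NormedAddCommGroup F] [NormedSpace ℝ F]

/-- An orthogonal bilinear map evaluated at a ramp and `1` only sees two adjacent tents. -/
lemma map_unitRamp_one_sub {W : C(X, ℝ) →ₗ[ℝ] C(X, ℝ) →ₗ[ℝ] F}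
    (hW : ∀ f g, f * g = 0 → W f g = 0) (g : C(X, ℝ)) (s : ℝ) :
    W (unitRamp g s) 1 - W 1 (unitRamp g s) =
      W (unitTent g (s + 1)) (unitTent g s) - W (unitTent g s) (unitTent g (s + 1)) := by
  have e₁ := hW _ _ (unitRamp_mul_one_sub g s)
  have e₂ := hW _ _ ((mul_comm _ _).trans (unitRamp_mul_one_sub g s))
  have e₃ := hW _ _ (unitRamp_mul_unitTent g s)
  have e₄ := hW _ _ ((mul_comm _ _).trans (unitRamp_mul_unitTent g s))
  have hu : unitRamp g (s - 1) = unitTent g s + unitRamp g s := by simp [unitTent]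
  have hv : unitTent g (s + 1) = unitRamp g s - unitRamp g (s + 1) := by simp [unitTent]
  rw [hu] at e₁ e₂
  rw [hv]
  simp only [map_sub, map_add, LinearMap.sub_apply, LinearMap.add_apply] at e₁ e₂ e₃ e₄ ⊢
  rw [sub_eq_zero] at e₁ e₂
  rw [e₁, e₂, e₃, e₄]
  abel

lemma map_sum_of_orthogonal {W : C(X, ℝ) →ₗ[ℝ] C(X, ℝ) →ₗ[ℝ] F}
    (u v : ℕ → C(X, ℝ)) (huv : ∀ i j, i ≠ j → W (u i) (v j) = 0) (m : ℕ) :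
    W (∑ j ∈ Finset.range m, u j) (∑ j ∈ Finset.range m, v j) =
      ∑ j ∈ Finset.range m, W (u j) (v j) := by
  simp only [map_sum, LinearMap.sum_apply]
  rw [Finset.sum_comm]
  refine Finset.sum_congr rfl fun i hi => ?_
  exact Finset.sum_eq_single_of_mem i hi fun j _ hj => huv _ _ hj.symm

lemma norm_map_sum_unitRamp_le [CompactSpace X] {W : C(X, ℝ) →ₗ[ℝ] C(X, ℝ) →ₗ[ℝ] F} {K : ℝ}
    (hW : ∀ f g, f * g = 0 → W f g = 0) (hK : ∀ f g, ‖W f g‖ ≤ K * ‖f‖ * ‖g‖) (hK₀ : 0 ≤ K)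
    (g : C(X, ℝ)) (s : ℝ) (m : ℕ) :
    ‖∑ j ∈ Finset.range m,
      (W (unitRamp g (s + 3 * j)) 1 - W 1 (unitRamp g (s + 3 * j)))‖ ≤ 2 * K := by
  have hcross : ∀ i j : ℕ, i ≠ j →
      unitTent g (s + 1 + 3 * i) * unitTent g (s + 3 * j) = 0 := by
    intro i j hij
    rcases lt_or_gt_of_ne hij with h | h
    · have : (i : ℝ) + 1 ≤ j := by exact_mod_cast h
      exact unitTent_mul_unitTent (by linarith)
    · have : (j : ℝ) + 1 ≤ i := by exact_mod_cast h
      rw [mul_comm]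
      exact unitTent_mul_unitTent (by linarith)
  have hs : ∀ j : ℕ, s + 3 * (j : ℝ) + 1 = s + 1 + 3 * j := fun j => by ring
  simp only [map_unitRamp_one_sub hW, hs, Finset.sum_sub_distrib]
  rw [← map_sum_of_orthogonal (fun j : ℕ => unitTent g (s + 1 + 3 * j))
      (fun j : ℕ => unitTent g (s + 3 * j)) (fun i j hij => hW _ _ (hcross i j hij)),
    ← map_sum_of_orthogonal (fun j : ℕ => unitTent g (s + 3 * j))
      (fun j : ℕ => unitTent g (s + 1 + 3 * j))
      (fun i j hij => hW _ _ ((mul_comm _ _).trans (hcross j i hij.symm)))]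
  have hb : ∀ f g : C(X, ℝ), ‖f‖ ≤ 1 → ‖g‖ ≤ 1 → ‖W f g‖ ≤ K := fun f g hf hg =>
    (hK f g).trans <| by
      calc K * ‖f‖ * ‖g‖ ≤ K * 1 * 1 := by gcongr
        _ = K := by ring
  refine (norm_sub_le _ _).trans ?_
  linarith [hb _ _ (norm_sum_unitTent_le g (s + 1) m) (norm_sum_unitTent_le g s m),
    hb _ _ (norm_sum_unitTent_le g s m) (norm_sum_unitTent_le g (s + 1) m)]

lemma norm_map_one_sub_le [CompactSpace X] {W : C(X, ℝ) →ₗ[ℝ] C(X, ℝ) →ₗ[ℝ] F} {K : ℝ}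
    (hW : ∀ f g, f * g = 0 → W f g = 0) (hK : ∀ f g, ‖W f g‖ ≤ K * ‖f‖ * ‖g‖) (hK₀ : 0 ≤ K)
    {g : C(X, ℝ)} (hg : ∀ x, 0 ≤ g x) : ‖W g 1 - W 1 g‖ ≤ 6 * K := by
  obtain ⟨m, hm⟩ := exists_nat_ge ‖g‖
  have hgm : ∀ x, g x ≤ 3 * m := fun x => by
    linarith [(le_abs_self _).trans (g.norm_coe_le_norm x), norm_nonneg g]
  have key : W g 1 - W 1 g =
      ∑ j ∈ Finset.range m, (W (unitRamp g (0 + 3 * j)) 1 - W 1 (unitRamp g (0 + 3 * j))) +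
      ∑ j ∈ Finset.range m, (W (unitRamp g (1 + 3 * j)) 1 - W 1 (unitRamp g (1 + 3 * j))) +
      ∑ j ∈ Finset.range m, (W (unitRamp g (2 + 3 * j)) 1 - W 1 (unitRamp g (2 + 3 * j))) := by
    conv_lhs => rw [← sum_unitRamp hg hgm]
    simp only [map_sum, LinearMap.sum_apply, map_add, LinearMap.add_apply,
      ← Finset.sum_add_distrib, ← Finset.sum_sub_distrib]
    refine Finset.sum_congr rfl fun j _ => ?_
    abel
  rw [key]
  refine (norm_add₃_le).trans ?_
  linarith [norm_map_sum_unitRamp_le hW hK hK₀ g 0 m, norm_map_sum_unitRamp_le hW hK hK₀ g 1 m,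
    norm_map_sum_unitRamp_le hW hK hK₀ g 2 m]

/-- A bounded bilinear map on `C(X, ℝ)` vanishing on pairs with zero product satisfies
`W f 1 = W 1 f`. -/
theorem orthogonal_bilinear_map_one_comm [CompactSpace X]
    {W : C(X, ℝ) →ₗ[ℝ] C(X, ℝ) →ₗ[ℝ] F} {K : ℝ}
    (hW : ∀ f g, f * g = 0 → W f g = 0) (hK : ∀ f g, ‖W f g‖ ≤ K * ‖f‖ * ‖g‖) (hK₀ : 0 ≤ K)
    (f : C(X, ℝ)) : W f 1 = W 1 f := by
  have hpos : ∀ g : C(X, ℝ), (∀ x, 0 ≤ g x) → W g 1 - W 1 g = 0 := by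
    intro g hg
    by_contra hne
    obtain ⟨n, hn⟩ := exists_nat_gt (6 * K / ‖W g 1 - W 1 g‖)
    have hlt := (div_lt_iff₀ (norm_pos_iff.2 hne)).1 hn
    have hle := norm_map_one_sub_le hW hK hK₀ (g := (n : ℝ) • g)
      fun x => mul_nonneg n.cast_nonneg (hg x)
    rw [map_smul, map_smul, LinearMap.smul_apply, ← smul_sub, norm_smul, Real.norm_natCast] at hle
    linarith
  have h := hpos (f + ‖f‖ • 1) fun x => by
    have := (abs_le.1 (f.norm_coe_le_norm x)).1
    simp
    linarith
  simp only [map_add, map_smul, LinearMap.add_apply, LinearMap.smul_apply,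
    add_sub_add_right_eq_sub] at h
  exact sub_eq_zero.1 h

end OrthogonalForms

/-- The real bilinear map `(x, y) ↦ T x * y + y * T x - (x * T y + T y * x)`. -/
noncomputable def jordanCommForm {B : Type*} [NormedRing B] [NormedAlgebra ℂ B] (T : B →L[ℂ] B) :
    B →ₗ[ℝ] B →ₗ[ℝ] B :=
  LinearMap.mk₂ ℝ (fun x y => T x * y + y * T x - (x * T y + T y * x))
    (fun x x' y => by simp only [map_add]; noncomm_ring)
    (fun r x y => by
      simp only [← Complex.coe_smul, map_smul, smul_mul_assoc, mul_smul_comm, smul_sub, smul_add])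
    (fun x y y' => by simp only [map_add]; noncomm_ring)
    (fun r x y => by
      simp only [← Complex.coe_smul, map_smul, smul_mul_assoc, mul_smul_comm, smul_sub, smul_add])

lemma jordanCommForm_apply {B : Type*} [NormedRing B] [NormedAlgebra ℂ B] (T : B →L[ℂ] B)
    (x y : B) :
    jordanCommForm T x y = T x * y + y * T x - (x * T y + T y * x) := rfl

lemma norm_jordanCommForm_le {B : Type*} [NormedRing B] [NormedAlgebra ℂ B] (T : B →L[ℂ] B)
    (x y : B) :
    ‖jordanCommForm T x y‖ ≤ 4 * ‖T‖ * ‖x‖ * ‖y‖ := by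
  have hm : ∀ u v : B, ‖T u * v‖ ≤ ‖T‖ * ‖u‖ * ‖v‖ := fun u v =>
    (norm_mul_le _ _).trans (by gcongr; exact T.le_opNorm u)
  have hm' : ∀ u v : B, ‖v * T u‖ ≤ ‖v‖ * (‖T‖ * ‖u‖) := fun u v =>
    (norm_mul_le _ _).trans (by gcongr; exact T.le_opNorm u)
  rw [jordanCommForm_apply]
  refine (norm_sub_le _ _).trans ?_
  refine (add_le_add (norm_add_le _ _) (norm_add_le _ _)).trans ?_
  linarith [hm x y, hm' x y, hm y x, hm' y x]

lemma jordanCommForm_eq_zero {B : Type*} [NormedRing B] [StarRing B] [NormedAlgebra ℂ B]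
    {T : B →L[ℂ] B} (hanti : ∀ x : B, star (T (star x)) = -T x)
    (hT : ∀ a b : B, IsSelfAdjoint a → IsSelfAdjoint b → a * b = 0 →
      tp (T a) b 1 + tp a (T b) 1 = 0)
    {a b : B} (ha : IsSelfAdjoint a) (hb : IsSelfAdjoint b) (hab : a * b = 0) :
    jordanCommForm T a b = 0 := by
  have h := hT a b ha hb hab
  have hTb := hanti b
  rw [hb.star_eq] at hTb
  rw [tp, tp, ← smul_add, hb.star_eq, hTb, smul_eq_zero_iff_right (by norm_num)] at h
  rw [jordanCommForm_apply, ← h]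
  noncomm_ring

lemma apply_isSelfAdjoint {T : A →L[ℂ] A} (hanti : ∀ x : A, star (T (star x)) = -T x)
    (hT : ∀ a b : A, IsSelfAdjoint a → IsSelfAdjoint b → a * b = 0 →
      tp (T a) b 1 + tp a (T b) 1 = 0)
    {a : A} (ha : IsSelfAdjoint a) : T a = (2⁻¹ : ℂ) • (T 1 * a + a * T 1) := by
  let _ : CStarAlgebra A := {}
  let Φ : C(spectrum ℝ a, ℝ) →⋆ₐ[ℝ] A := cfcHom ha
  have hΦ : ∀ f, IsSelfAdjoint (Φ f) := fun f => by
    rw [IsSelfAdjoint, ← map_star, star_trivial]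
  have h := orthogonal_bilinear_map_one_comm
    (W := (jordanCommForm T).compl₁₂ Φ.toAlgHom.toLinearMap Φ.toAlgHom.toLinearMap)
    (K := 4 * ‖T‖)
    (fun f g hfg => jordanCommForm_eq_zero hanti hT (hΦ f) (hΦ g) (by
      exact (map_mul Φ f g).symm.trans (by rw [hfg, map_zero])))
    (fun f g => (norm_jordanCommForm_le T (Φ f) (Φ g)).trans_eq (by
      rw [norm_cfcHom a f ha, norm_cfcHom a g ha]))
    (by positivity) ((ContinuousMap.id ℝ).restrict (spectrum ℝ a))
  have hid : Φ ((ContinuousMap.id ℝ).restrict (spectrum ℝ a)) = a := cfcHom_id ha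
  change jordanCommForm T (Φ _) (Φ 1) = jordanCommForm T (Φ 1) (Φ _) at h
  rw [hid, map_one, jordanCommForm_apply, jordanCommForm_apply] at h
  simp only [mul_one, one_mul] at h
  have h4 : (4 : ℂ) • T a = (4 : ℂ) • ((2⁻¹ : ℂ) • (T 1 * a + a * T 1)) := by
    rw [← sub_eq_zero] at h ⊢
    rw [← h]
    module
  exact smul_right_injective A (by norm_num : (4 : ℂ) ≠ 0) h4

/-- an anti-symmetric bounded linear map on a unital C*-algebra satisfying
`{T a, b, 1} + {a, T b, 1} = 0` for all orthogonal self-adjoint `a, b` has `T 1`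
skew-adjoint, `T x = (1/2)(T 1 * x + x * T 1)`, and `T` is a triple derivation. -/
theorem stmt15 (T : A →L[ℂ] A)
    (hanti : ∀ x : A, star (T (star x)) = -T x)
    (hT : ∀ a b : A, IsSelfAdjoint a → IsSelfAdjoint b → a * b = 0 →
      tp (T a) b 1 + tp a (T b) 1 = 0) :
    star (T 1) = -T 1 ∧
    (∀ x : A, T x = (2⁻¹ : ℂ) • (T 1 * x + x * T 1)) ∧
    IsTripleDerivation (T : A → A) := by
  have hskew : star (T 1) = -T 1 := by simpa using hanti 1
  have hform : ∀ x : A, T x = (2⁻¹ : ℂ) • (T 1 * x + x * T 1) := by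
    intro x
    have hre := apply_isSelfAdjoint hanti hT (realPart x).2
    have him := apply_isSelfAdjoint hanti hT (imaginaryPart x).2
    rw [← realPart_add_I_smul_imaginaryPart x, map_add, map_smul, hre, him]
    simp only [mul_add, add_mul, smul_add, smul_mul_assoc, mul_smul_comm,
      smul_comm (2⁻¹ : ℂ) Complex.I]
    abel
  refine ⟨hskew, hform, fun a b c => ?_⟩
  have hstar : star (T b) = -T (star b) := by simpa using hanti (star b)
  simp only [tp]
  rw [hstar, map_smul, hform (a * star b * c + c * star b * a), hform a, hform (star b), hform c]
  simp only [mul_add, add_mul, smul_add, neg_mul, mul_neg, smul_mul_assoc, mul_smul_comm, mul_assoc,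
    smul_neg]
  module
end
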